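/- Let Σx ∈ ℝ^{d×d} and Σxy ∈ ℝ^{d×p} be real matrices, and let W₁ : [0, ∞) → ℝ^{d×r} and W₂ : [0, ∞) → ℝ^{r×p} be continuously differentiable matrix-valued functions satisfying Ẇ₁(t) = (Σxy − Σx·W₁(t)·W₂(t))·W₂(t)ᵀ and Ẇ₂(t) = W₁(t)ᵀ·(Σxy − Σx·W₁(t)·W₂(t)) for all t ≥ 0. If there exists M > 0 with ‖W₁(t)·W₂(t)‖ ≤ M for all t ≥ 0, then ‖W₁(t)‖² ≤ ‖W₁(0)‖² + 2·M·(‖Σxy‖ + ‖Σx‖·M)·t and ‖W₂(t)‖² ≤ ‖W₂(0)‖² + 2·M·(‖Σxy‖ + ‖Σx‖·M)·t for all t ≥ 0; in particular ‖W₁(t)‖² = O(t) and ‖W₂(t)‖² = O(t). -/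

import Mathlib

open Matrix

/-- The Frobenius norm of a real matrix. -/
noncomputable def frobNorm {a b : ℕ} (M : Matrix (Fin a) (Fin b) ℝ) : ℝ :=
  Real.sqrt (∑ i, ∑ j, (M i j) ^ 2)

section Frobenius

attribute [local instance] Matrix.frobeniusNormedAddCommGroup Matrix.frobeniusNormedSpace

theorem frobNorm_eq_norm {a b : ℕ} (A : Matrix (Fin a) (Fin b) ℝ) : frobNorm A = ‖A‖ := by
  simp [frobNorm, Matrix.frobenius_norm_def, Real.sqrt_eq_rpow]

theorem frobNorm_sub_le {a b : ℕ} (A B : Matrix (Fin a) (Fin b) ℝ) :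
    frobNorm (A - B) ≤ frobNorm A + frobNorm B := by
  simpa only [frobNorm_eq_norm] using norm_sub_le A B

theorem frobNorm_mul_le {a b c : ℕ} (A : Matrix (Fin a) (Fin b) ℝ)
    (B : Matrix (Fin b) (Fin c) ℝ) : frobNorm (A * B) ≤ frobNorm A * frobNorm B := by
  simpa only [frobNorm_eq_norm] using Matrix.frobenius_norm_mul A B

end Frobenius

theorem frobNorm_nonneg {a b : ℕ} (A : Matrix (Fin a) (Fin b) ℝ) : 0 ≤ frobNorm A :=
  Real.sqrt_nonneg _

theorem frobNorm_sq {a b : ℕ} (A : Matrix (Fin a) (Fin b) ℝ) :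
    frobNorm A ^ 2 = ∑ i, ∑ j, A i j ^ 2 :=
  Real.sq_sqrt (by positivity)

theorem trace_transpose_mul_eq_sum {a b : ℕ} (A B : Matrix (Fin a) (Fin b) ℝ) :
    (Aᵀ * B).trace = ∑ i, ∑ j, A i j * B i j := by
  rw [Finset.sum_comm]
  simp [Matrix.trace, Matrix.mul_apply]

theorem trace_transpose_mul_le {a b : ℕ} (A B : Matrix (Fin a) (Fin b) ℝ) :
    (Aᵀ * B).trace ≤ frobNorm A * frobNorm B := by
  simp only [trace_transpose_mul_eq_sum, frobNorm, ← Fintype.sum_prod_type']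
  exact Real.sum_mul_le_sqrt_mul_sqrt _ _ _

theorem hasDerivAt_frobNorm_sq {a b : ℕ} {W : ℝ → Matrix (Fin a) (Fin b) ℝ}
    {W' : Matrix (Fin a) (Fin b) ℝ} {t : ℝ}
    (hW : ∀ i j, HasDerivAt (fun s => W s i j) (W' i j) t) :
    HasDerivAt (fun s => frobNorm (W s) ^ 2) (2 * ((W t)ᵀ * W').trace) t := by
  simp only [frobNorm_sq, trace_transpose_mul_eq_sum, Finset.mul_sum]
  refine HasDerivAt.fun_sum fun i _ => HasDerivAt.fun_sum fun j _ => ?_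
  exact ((hW i j).fun_pow 2).congr_deriv (by push_cast; ring)

/-- A function whose derivative is at most `K` on `[0, ∞)` grows at most linearly with slope `K`. -/
theorem le_add_mul_of_hasDerivAt_le {f f' : ℝ → ℝ} {K : ℝ}
    (hf : ∀ t, 0 ≤ t → HasDerivAt f (f' t) t) (hK : ∀ t, 0 ≤ t → f' t ≤ K)
    {t : ℝ} (ht : 0 ≤ t) : f t ≤ f 0 + K * t := by
  have h := (convex_Ici (0 : ℝ)).image_sub_le_mul_sub_of_deriv_le (f := f) (C := K)
    (fun x hx => (hf x hx).continuousAt.continuousWithinAt)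
    (fun x hx => (hf x (interior_subset hx)).differentiableAt.differentiableWithinAt)
    (fun x hx => (hf x (interior_subset hx)).deriv ▸ hK x (interior_subset hx))
    0 Set.self_mem_Ici t ht ht
  linarith

theorem exists_pos_le_mul_one_add_of_le_add_mul {f : ℝ → ℝ} {a K : ℝ} (ha : 0 ≤ a) (hK : 0 ≤ K)
    (hf : ∀ t, 0 ≤ t → f t ≤ a + K * t) : ∃ C > (0 : ℝ), ∀ t, 0 ≤ t → f t ≤ C * (1 + t) := by
  refine ⟨a + K + 1, by positivity, fun t ht => (hf t ht).trans ?_⟩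
  nlinarith [mul_nonneg ha ht]

/-- Compactness lemma: along the two-layer gradient flow, if the product
`W₁(t)W₂(t)` stays bounded by `M`, then
`‖Wℓ(t)‖² ≤ ‖Wℓ(0)‖² + 2M(‖Σxy‖ + ‖Σx‖M)t` for `ℓ ∈ {1,2}`;
in particular `‖W₁(t)‖² = O(t)` and `‖W₂(t)‖² = O(t)`. -/
theorem stmt_19 (d p r : ℕ)
    (Sx : Matrix (Fin d) (Fin d) ℝ) (Sxy : Matrix (Fin d) (Fin p) ℝ)
    (W₁ : ℝ → Matrix (Fin d) (Fin r) ℝ) (W₂ : ℝ → Matrix (Fin r) (Fin p) ℝ)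
    (hW₁ : ∀ t : ℝ, 0 ≤ t → ∀ (i : Fin d) (j : Fin r),
      HasDerivAt (fun s : ℝ => W₁ s i j)
        (((Sxy - Sx * (W₁ t * W₂ t)) * (W₂ t)ᵀ) i j) t)
    (hW₂ : ∀ t : ℝ, 0 ≤ t → ∀ (i : Fin r) (j : Fin p),
      HasDerivAt (fun s : ℝ => W₂ s i j)
        (((W₁ t)ᵀ * (Sxy - Sx * (W₁ t * W₂ t))) i j) t)
    (M : ℝ) (hM : 0 < M)
    (hbound : ∀ t : ℝ, 0 ≤ t → frobNorm (W₁ t * W₂ t) ≤ M) :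
    (∀ t : ℝ, 0 ≤ t → frobNorm (W₁ t) ^ 2
      ≤ frobNorm (W₁ 0) ^ 2 + 2 * M * (frobNorm Sxy + frobNorm Sx * M) * t) ∧
    (∀ t : ℝ, 0 ≤ t → frobNorm (W₂ t) ^ 2
      ≤ frobNorm (W₂ 0) ^ 2 + 2 * M * (frobNorm Sxy + frobNorm Sx * M) * t) ∧
    (∃ C > (0 : ℝ), ∀ t : ℝ, 0 ≤ t → frobNorm (W₁ t) ^ 2 ≤ C * (1 + t)) ∧
    (∃ C > (0 : ℝ), ∀ t : ℝ, 0 ≤ t → frobNorm (W₂ t) ^ 2 ≤ C * (1 + t)) := by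
  set K := 2 * M * (frobNorm Sxy + frobNorm Sx * M)
  have hK : 0 ≤ K := by
    have := frobNorm_nonneg Sxy
    have := frobNorm_nonneg Sx
    positivity
  have hR (t : ℝ) (ht : 0 ≤ t) :
      2 * ((W₁ t * W₂ t)ᵀ * (Sxy - Sx * (W₁ t * W₂ t))).trace ≤ K := by
    have hres : frobNorm (Sxy - Sx * (W₁ t * W₂ t)) ≤ frobNorm Sxy + frobNorm Sx * M := by
      refine (frobNorm_sub_le _ _).trans ?_
      gcongr
      refine (frobNorm_mul_le _ _).trans ?_
      gcongr
      exacts [frobNorm_nonneg _, hbound t ht]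
    have hprod := (trace_transpose_mul_le (W₁ t * W₂ t) (Sxy - Sx * (W₁ t * W₂ t))).trans
      (mul_le_mul (hbound t ht) hres (frobNorm_nonneg _) hM.le)
    simp only [K]
    linarith
  have h₁ (t : ℝ) (ht : 0 ≤ t) : frobNorm (W₁ t) ^ 2 ≤ frobNorm (W₁ 0) ^ 2 + K * t := by
    refine le_add_mul_of_hasDerivAt_le (f := fun s => frobNorm (W₁ s) ^ 2)
      (fun s hs => hasDerivAt_frobNorm_sq (hW₁ s hs)) (fun s hs => ?_) ht
    convert hR s hs using 2
    rw [← Matrix.mul_assoc, Matrix.trace_mul_comm, ← Matrix.mul_assoc, ← Matrix.transpose_mul]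
  have h₂ (t : ℝ) (ht : 0 ≤ t) : frobNorm (W₂ t) ^ 2 ≤ frobNorm (W₂ 0) ^ 2 + K * t := by
    refine le_add_mul_of_hasDerivAt_le (f := fun s => frobNorm (W₂ s) ^ 2)
      (fun s hs => hasDerivAt_frobNorm_sq (hW₂ s hs)) (fun s hs => ?_) ht
    convert hR s hs using 2
    rw [← Matrix.mul_assoc, ← Matrix.transpose_mul]
  exact ⟨h₁, h₂, exists_pos_le_mul_one_add_of_le_add_mul (sq_nonneg _) hK h₁,
    exists_pos_le_mul_one_add_of_le_add_mul (sq_nonneg _) hK h₂⟩
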